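/- Let u, v > 0 with u ≤ v and α ∈ (0,1]. With h_α(u,v)² = |u−v|² + 2uv·(1 − Ψ_α((u−v)/v)), where Ψ_α(y) = √(1 − (α|y| ∧ 1)), one has h_α(u,v)² ≥ |u−v|² + α·u·(v−u) ≥ α·u·(v−u). -/

import Mathlib

/-- For `0 < u ≤ v` and `α ∈ (0,1]`, with
`h_α(u,v)² = |u−v|² + 2uv·(1 − Ψ_α((u−v)/v))` where `Ψ_α(y) = √(1 − (α|y| ∧ 1))`,
one has `h_α(u,v)² ≥ |u−v|² + α·u·(v−u) ≥ α·u·(v−u)`. -/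
theorem stmt_5 (u v α : ℝ) (hu : 0 < u) (huv : u ≤ v)
    (hα : α ∈ Set.Ioc (0:ℝ) 1) :
    |u - v| ^ 2 + 2 * u * v * (1 - Real.sqrt (1 - min (α * |(u - v) / v|) 1))
        ≥ |u - v| ^ 2 + α * u * (v - u) ∧
    |u - v| ^ 2 + α * u * (v - u) ≥ α * u * (v - u) := by
  obtain ⟨h0, h1⟩ := hα
  have hv : 0 < v := lt_of_lt_of_le hu huv
  refine ⟨?_, by nlinarith [sq_nonneg |u - v|]⟩
  have habs : |(u - v) / v| = (v - u) / v := by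
    rw [abs_div, abs_of_pos hv, abs_of_nonpos (by linarith), neg_sub]
  have hy0 : 0 ≤ (v - u) / v := div_nonneg (by linarith) hv.le
  have hy1 : (v - u) / v ≤ 1 := by
    rw [div_le_one hv]; linarith
  have ht1 : α * ((v - u) / v) ≤ 1 := by nlinarith
  rw [habs, min_eq_left ht1]
  have hs : Real.sqrt (1 - α * ((v - u) / v)) ≤ 1 - α * ((v - u) / v) / 2 := by
    apply Real.sqrt_le_iff.mpr
    constructor
    · linarith
    · nlinarith [sq_nonneg (α * ((v - u) / v))]
  have hm := mul_le_mul_of_nonneg_left hs (by positivity : (0:ℝ) ≤ 2 * u * v)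
  have he : 2 * u * v * (1 - α * ((v - u) / v) / 2) = 2 * u * v - α * u * (v - u) := by
    field_simp
  rw [he] at hm
  linarith
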